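/- The number of knot (5,6)-mosaics is D_{5,6} = 331745962. -/

import Mathlib

/-- The eleven mosaic tiles `T₀, …, T₁₀`. -/
inductive Tile : Type
  | T0 | T1 | T2 | T3 | T4 | T5 | T6 | T7 | T8 | T9 | T10
  deriving DecidableEq

namespace Tile

/-- Whether the top edge of a tile carries a connection point.
`T0` has no connection points; `T1,…,T6` realize the six unordered pairs of edges
(`T1`: bottom–left, `T2`: bottom–right, `T3`: top–right, `T4`: top–left,
`T5`: left–right, `T6`: top–bottom); `T7,…,T10` have all four. -/
def top : Tile → Bool
  | .T3 | .T4 | .T6 | .T7 | .T8 | .T9 | .T10 => true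
  | _ => false

/-- Whether the bottom edge of a tile carries a connection point. -/
def bottom : Tile → Bool
  | .T1 | .T2 | .T6 | .T7 | .T8 | .T9 | .T10 => true
  | _ => false

/-- Whether the left edge of a tile carries a connection point. -/
def left : Tile → Bool
  | .T1 | .T4 | .T5 | .T7 | .T8 | .T9 | .T10 => true
  | _ => false

/-- Whether the right edge of a tile carries a connection point. -/
def right : Tile → Bool
  | .T2 | .T3 | .T5 | .T7 | .T8 | .T9 | .T10 => true
  | _ => false

end Tile

/-- An `(m,n)`-mosaic `M : Fin m → Fin n → Tile` (rows indexed top-to-bottom,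
columns left-to-right) is suitably connected if any pair of contiguous tiles
have or do not have connection points simultaneously on their common edge. -/
def SuitablyConnected {m n : ℕ} (M : Fin m → Fin n → Tile) : Prop :=
  (∀ (i : Fin m) (j : Fin n) (h : (j : ℕ) + 1 < n),
    (M i j).right = (M i ⟨(j : ℕ) + 1, h⟩).left) ∧
  (∀ (i : Fin m) (j : Fin n) (h : (i : ℕ) + 1 < m),
    (M i j).bottom = (M ⟨(i : ℕ) + 1, h⟩ j).top)

/-- None of the boundary edges of the mosaic carries a connection point. -/
def BoundaryFree {m n : ℕ} (M : Fin m → Fin n → Tile) : Prop :=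
  ∀ (i : Fin m) (j : Fin n),
    ((i : ℕ) = 0 → (M i j).top = false) ∧
    ((i : ℕ) = m - 1 → (M i j).bottom = false) ∧
    ((j : ℕ) = 0 → (M i j).left = false) ∧
    ((j : ℕ) = n - 1 → (M i j).right = false)

/-- A knot `(m,n)`-mosaic is a suitably connected mosaic none of whose boundary
edges has a connection point. -/
def IsKnotMosaic {m n : ℕ} (M : Fin m → Fin n → Tile) : Prop :=
  SuitablyConnected M ∧ BoundaryFree M

/-- `D m n`, the number of knot `(m,n)`-mosaics. -/
noncomputable def knotMosaicCount (m n : ℕ) : ℕ :=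
  Nat.card {M : Fin m → Fin n → Tile // IsKnotMosaic M}

/-- `|Q^{(p,q)}|`, the number of `(p,q)`-quasimosaics (suitably connected
`(p,q)`-mosaics, with connection points allowed on boundary edges). -/
noncomputable def quasimosaicCount (p q : ℕ) : ℕ :=
  Nat.card {M : Fin p → Fin q → Tile // SuitablyConnected M}

namespace Tile

instance : Fintype Tile where
  elems := {.T0, .T1, .T2, .T3, .T4, .T5, .T6, .T7, .T8, .T9, .T10}
  complete := by rintro (_ | _) <;> decide

theorem card_edges (t b l r : Bool) :
    Nat.card {a : Tile // (a.top = t ∧ a.bottom = b) ∧ a.left = l ∧ a.right = r} =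
      if xor (xor t b) (xor l r) then 0 else if t && b && l && r then 4 else 1 := by
  rw [Nat.card_eq_fintype_card]
  revert t b l r
  decide

end Tile

section Path

variable {A S : Type*}

/-- `x 0, …, x (n - 1)` is a path of arrows of the graph with source map `src` and target map `tgt`,
starting at `s` and ending at `t`. -/
def IsPath (src tgt : A → S) (t : S) : (n : ℕ) → S → (Fin n → A) → Prop
  | 0, s, _ => s = t
  | n + 1, s, x => src (x 0) = s ∧ IsPath src tgt t n (tgt (x 0)) (Fin.tail x)

theorem isPath_succ_iff (src tgt : A → S) (t : S) (n : ℕ) (s : S) (x : Fin (n + 1) → A) :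
    IsPath src tgt t (n + 1) s x ↔
      src (x 0) = s ∧ (∀ i : Fin n, tgt (x i.castSucc) = src (x i.succ)) ∧
        tgt (x (Fin.last n)) = t := by
  induction n generalizing s with
  | zero => simp [IsPath]
  | succ n ih =>
    rw [IsPath, ih, Fin.forall_fin_succ (n := n)]
    simp [Fin.tail, eq_comm, and_assoc]

theorem card_isPath_succ [Finite A] [Fintype S] (src tgt : A → S) (t : S) (n : ℕ) (s : S)
    (P : Fin (n + 1) → A → Prop) :
    Nat.card {x : Fin (n + 1) → A // IsPath src tgt t (n + 1) s x ∧ ∀ i, P i (x i)} =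
      ∑ u, Nat.card {a // P 0 a ∧ src a = s ∧ tgt a = u} *
        Nat.card {x : Fin n → A // IsPath src tgt t n u x ∧ ∀ i, P i.succ (x i)} := by
  simp_rw [← Nat.card_prod]
  rw [← Nat.card_sigma]
  refine Nat.card_congr
    { toFun := fun x => ⟨tgt (x.1 0), ⟨x.1 0, x.2.2 0, x.2.1.1, rfl⟩,
        ⟨Fin.tail x.1, x.2.1.2, fun i => x.2.2 i.succ⟩⟩
      invFun := fun y => ⟨Fin.cons y.2.1.1 y.2.2.1, ?_, ?_⟩
      left_inv := ?_
      right_inv := ?_ }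
  · obtain ⟨u, ⟨a, _, h, rfl⟩, ⟨x, hx, _⟩⟩ := y
    exact ⟨h, by simpa using hx⟩
  · obtain ⟨u, ⟨a, h, _⟩, ⟨x, _, hx⟩⟩ := y
    exact Fin.cases h hx
  · rintro ⟨x, hx⟩
    simp
  · rintro ⟨u, ⟨a, _, h, rfl⟩, ⟨x, hx, _⟩⟩
    rfl

end Path

/-- The number of rows with left and right ends `l` and `false`, top edges `s` and bottom
edges `u`. -/
noncomputable def rowCount (n : ℕ) (l : Bool) (s u : Fin n → Bool) : ℕ :=
  Nat.card {r : Fin n → Tile // IsPath Tile.left Tile.right false n l r ∧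
    ∀ i, (r i).top = s i ∧ (r i).bottom = u i}

/-- The number of `(m, n)`-mosaics with top edges `s` and no connection point on the other
boundary edges. -/
noncomputable def stackCount (n m : ℕ) (s : Fin n → Bool) : ℕ :=
  Nat.card {M : Fin m → Fin n → Tile //
    IsPath (fun r j => (r j).top) (fun r j => (r j).bottom) (fun _ => false) m s M ∧
    ∀ i, IsPath Tile.left Tile.right false n false (M i)}

theorem rowCount_zero (l : Bool) (s u : Fin 0 → Bool) :
    rowCount 0 l s u = if l then 0 else 1 := by
  cases l <;> simp [rowCount, IsPath]

theorem rowCount_succ (n : ℕ) (l : Bool) (s u : Fin (n + 1) → Bool) :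
    rowCount (n + 1) l s u = ∑ r, (if xor (xor (s 0) (u 0)) (xor l r) then 0 else
      if s 0 && u 0 && l && r then 4 else 1) * rowCount n r (Fin.tail s) (Fin.tail u) := by
  refine (card_isPath_succ _ _ _ _ _ fun i (a : Tile) => a.top = s i ∧ a.bottom = u i).trans ?_
  simp only [Tile.card_edges]
  rfl

theorem stackCount_zero (n : ℕ) (s : Fin n → Bool) :
    stackCount n 0 s = if s = fun _ => false then 1 else 0 := by
  by_cases h : s = fun _ => false <;> simp [stackCount, IsPath, h]

theorem stackCount_succ (n m : ℕ) (s : Fin n → Bool) :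
    stackCount n (m + 1) s = ∑ u, rowCount n false s u * stackCount n m u := by
  rw [stackCount, card_isPath_succ _ _ _ _ _ fun _ r => IsPath Tile.left Tile.right false n false r]
  simp only [funext_iff, ← forall_and]
  rfl

theorem isKnotMosaic_iff {m n : ℕ} (M : Fin (m + 1) → Fin (n + 1) → Tile) :
    IsKnotMosaic M ↔
      IsPath (fun r j => (r j).top) (fun r j => (r j).bottom) (fun _ => false) (m + 1)
        (fun _ => false) M ∧
      ∀ i, IsPath Tile.left Tile.right false (n + 1) false (M i) := by
  simp only [isPath_succ_iff, funext_iff]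
  constructor
  · rintro ⟨⟨hr, hb⟩, h⟩
    exact ⟨⟨fun j => (h 0 j).1 rfl, fun i j => hb i.castSucc j (by simp),
      fun j => (h (Fin.last m) j).2.1 rfl⟩, fun i => ⟨(h i 0).2.2.1 rfl,
      fun j => hr i j.castSucc (by simp), (h i (Fin.last n)).2.2.2 rfl⟩⟩
  · rintro ⟨⟨ht, hv, hb⟩, h⟩
    refine ⟨⟨fun i j hj => (h i).2.1 ⟨j, by omega⟩, fun i j hi => hv ⟨i, by omega⟩ j⟩,
      fun i j => ⟨fun hi => ?_, fun hi => ?_, fun hj => ?_, fun hj => ?_⟩⟩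
    · obtain rfl : i = 0 := Fin.ext hi
      exact ht j
    · obtain rfl : i = Fin.last m := Fin.ext hi
      exact hb j
    · obtain rfl : j = 0 := Fin.ext hj
      exact (h i).1
    · obtain rfl : j = Fin.last n := Fin.ext hj
      exact (h i).2.2

theorem knotMosaicCount_succ_succ (m n : ℕ) :
    knotMosaicCount (m + 1) (n + 1) = stackCount (n + 1) (m + 1) fun _ => false := by
  simp only [knotMosaicCount, isKnotMosaic_iff, stackCount]

/-- Functions `(Fin n → Bool) → ℕ`, stored as complete binary trees. -/
def StateVec : ℕ → Type
  | 0 => ℕ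
  | n + 1 => StateVec n × StateVec n

namespace StateVec

/-- The value of the function stored in a tree. -/
def get : (n : ℕ) → StateVec n → (Fin n → Bool) → ℕ
  | 0, v, _ => v
  | n + 1, v, s => get n (bif s 0 then v.2 else v.1) (Fin.tail s)

/-- The constant function `c`. -/
def const (c : ℕ) : (n : ℕ) → StateVec n
  | 0 => c
  | n + 1 => (const c n, const c n)

/-- The indicator function of the all-`false` state. -/
def unit : (n : ℕ) → StateVec n
  | 0 => (1 : ℕ)
  | n + 1 => (unit n, const 0 n)

/-- The function `v + c * w`. -/
def addMul (c : ℕ) : (n : ℕ) → StateVec n → StateVec n → StateVec n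
  | 0, v, w => Nat.add v (Nat.mul c w)
  | n + 1, v, w => (addMul c n v.1 w.1, addMul c n v.2 w.2)

/-- The product of the matrix `rowCount n l` with the vector `v`. -/
def sweep : (n : ℕ) → Bool → StateVec n → StateVec n
  | 0, l, v => bif l then (0 : ℕ) else v
  | n + 1, l, v =>
    (addMul 1 n (sweep n l v.1) (sweep n (!l) v.2),
      addMul (bif l then 4 else 1) n (sweep n (!l) v.1) (sweep n l v.2))

/-- Evaluates all entries of `v` before applying `k`, so that the kernel does not recompute them. -/
def force {α : Type*} : (n : ℕ) → StateVec n → (StateVec n → α) → α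
  | 0, v, k => Nat.casesOn (motive := fun _ => α) v (k (0 : ℕ)) fun m => k (m.succ : ℕ)
  | n + 1, v, k => force n v.1 fun a => force n v.2 fun b => k (a, b)

/-- The function `stackCount n m`. -/
def stack (n : ℕ) : ℕ → StateVec n
  | 0 => unit n
  | m + 1 => force n (stack n m) fun v => sweep n false v

theorem get_const (c n : ℕ) (s : Fin n → Bool) : get n (const c n) s = c := by
  induction n with
  | zero => rfl
  | succ n ih => cases h : s 0 <;> simp [get, const, h, ih]

theorem get_unit (n : ℕ) (s : Fin n → Bool) :
    get n (unit n) s = if s = fun _ => false then 1 else 0 := by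
  induction n with
  | zero => simp [get, unit, Subsingleton.elim s fun _ => false]
  | succ n ih =>
    cases h : s 0 <;> simp [get, unit, h, ih, get_const, funext_iff, Fin.forall_fin_succ, Fin.tail]

theorem get_addMul (c n : ℕ) (v w : StateVec n) (s : Fin n → Bool) :
    get n (addMul c n v w) s = get n v s + c * get n w s := by
  induction n with
  | zero => rfl
  | succ n ih => cases h : s 0 <;> simp [get, addMul, h, ih]

theorem get_sweep (n : ℕ) (l : Bool) (v : StateVec n) (s : Fin n → Bool) :
    get n (sweep n l v) s = ∑ u, rowCount n l s u * get n v u := by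
  induction n generalizing l with
  | zero =>
    rw [Fintype.sum_unique, rowCount_zero]
    cases l
    · exact (one_mul _).symm
    · exact (zero_mul _).symm
  | succ n ih =>
    rw [← (Fin.consEquiv fun _ => Bool).sum_comp, Fintype.sum_prod_type]
    cases h : s 0 <;> cases l <;>
      simp [get, sweep, h, rowCount_succ, get_addMul, ih, Fin.consEquiv, Finset.mul_sum,
        mul_assoc, add_comm]

theorem force_eq {α : Type*} (n : ℕ) (v : StateVec n) (k : StateVec n → α) :
    force n v k = k v := by
  induction n with
  | zero => cases v using Nat.casesOn <;> rfl
  | succ n ih =>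
    simp only [force, ih]
    rfl

theorem get_stack (n m : ℕ) (s : Fin n → Bool) : get n (stack n m) s = stackCount n m s := by
  induction m generalizing s with
  | zero => rw [stack, get_unit, stackCount_zero]
  | succ m ih => simp only [stack, force_eq, get_sweep, stackCount_succ, ih]

end StateVec

/-- The number of knot `(5,6)`-mosaics is `D_{5,6} = 331745962`. -/
theorem knotMosaicCount_five_six : knotMosaicCount 5 6 = 331745962 := by
  rw [knotMosaicCount_succ_succ, ← StateVec.get_stack]
  decide +kernel
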